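/- Let S be the formal power series Σ_{n ≥ 0} s_n(UHD) X^n, where s_n(UHD) is the number of Schröder words of semilength n avoiding the pattern UHD, and let C(X) = Σ_{n ≥ 0} C_n X^n be the generating function of the Catalan numbers. Then, as formal power series (over ℚ or ℤ), (1 − X)² · S = C(X) − X; equivalently S = (C(X) − X)/(1 − X)². -/

import Mathlib

/-- Steps of a Schröder path: `U` = (1,1), `D` = (1,-1), `H` = (2,0). -/
inductive Step : Type
  | U : Step
  | D : Step
  | H : Step
  deriving DecidableEq

/-- Number of `U` steps of a word. -/
def countU (w : List Step) : ℕ := w.count Step.U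

/-- Number of `D` steps of a word. -/
def countD (w : List Step) : ℕ := w.count Step.D

/-- Number of `H` steps of a word. -/
def countH (w : List Step) : ℕ := w.count Step.H

/-- A word is a Schröder word if every prefix has at least as many `U`'s as `D`'s
and the whole word has equally many `U`'s and `D`'s. -/
def IsSchroder (w : List Step) : Prop :=
  (∀ p : List Step, p <+: w → countD p ≤ countU p) ∧ countU w = countD w

/-- The semilength of a Schröder word. -/
def semilength (w : List Step) : ℕ := countU w + countH w

/-- `schroderAvoidCount n P` is the number of Schröder words of semilength `n`
avoiding the pattern `P` (i.e. not containing `P` as a not-necessarily-contiguous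
subword). -/
noncomputable def schroderAvoidCount (n : ℕ) (P : List Step) : ℕ :=
  Nat.card {w : List Step // IsSchroder w ∧ semilength w = n ∧ ¬ P.Sublist w}

lemma sch_cons_H (w : List Step) : IsSchroder (Step.H :: w) ↔ IsSchroder w := by
  unfold IsSchroder countU countD
  constructor
  · rintro ⟨h1, h2⟩
    refine ⟨fun p hp => ?_, by simpa using h2⟩
    have := h1 (Step.H :: p) (by simpa using hp)
    simpa using this
  · rintro ⟨h1, h2⟩
    refine ⟨fun p hp => ?_, by simpa using h2⟩
    rcases p with _ | ⟨a, p⟩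
    · simp
    · rw [List.cons_prefix_cons] at hp
      obtain ⟨rfl, hp⟩ := hp
      simpa using h1 p hp

lemma sch_append_H (w : List Step) : IsSchroder (w ++ [Step.H]) ↔ IsSchroder w := by
  unfold IsSchroder countU countD
  constructor
  · rintro ⟨h1, h2⟩
    refine ⟨fun p hp => h1 p (hp.trans (List.prefix_append _ _)), by simpa using h2⟩
  · rintro ⟨h1, h2⟩
    refine ⟨fun p hp => ?_, by simpa using h2⟩
    rw [List.prefix_concat_iff] at hp
    rcases hp with rfl | hp
    · simpa using h2.ge
    · exact h1 p hp

lemma avoid_cons_H (w : List Step) :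
    [Step.U, Step.H, Step.D].Sublist (Step.H :: w) ↔ [Step.U, Step.H, Step.D].Sublist w := by
  constructor
  · intro h
    cases h
    assumption
  · exact fun h => h.cons _

lemma avoid_append_H (w : List Step) :
    [Step.U, Step.H, Step.D].Sublist (w ++ [Step.H]) ↔ [Step.U, Step.H, Step.D].Sublist w := by
  rw [← List.reverse_sublist, ← List.reverse_sublist (l₂ := w)]
  simp only [List.reverse_append, List.reverse_cons, List.reverse_nil, List.nil_append,
    List.cons_append]
  constructor
  · intro h
    cases h
    assumption
  · exact fun h => h.cons _

def SA (n : ℕ) : Set (List Step) :=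
  {w | IsSchroder w ∧ semilength w = n ∧ ¬ [Step.U, Step.H, Step.D].Sublist w}

def SB (n : ℕ) : Set (List Step) := {w | w ∈ SA n ∧ w.head? ≠ some Step.H}

def SE (n : ℕ) : Set (List Step) := {w | w ∈ SB n ∧ w.getLast? ≠ some Step.H}

instance : Finite Step :=
  Finite.of_injective (fun s : Step => (decide (s = Step.U), decide (s = Step.D))) (by
    intro a b h
    cases a <;> cases b <;> simp_all)

lemma len_eq (w : List Step) : w.length = countU w + countD w + countH w := by
  unfold countU countD countH
  induction w with
  | nil => rfl
  | cons a w ih => cases a <;> simp [ih] <;> omega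

lemma SA_finite (n : ℕ) : (SA n).Finite := by
  refine (List.finite_length_le Step (2 * n)).subset ?_
  rintro w ⟨h1, h2, -⟩
  have := len_eq w
  have := h1.2
  unfold semilength at h2
  simp only [Set.mem_ofPred_eq]
  omega

lemma SB_finite (n : ℕ) : (SB n).Finite := (SA_finite n).subset fun _ h => h.1

lemma SE_finite (n : ℕ) : (SE n).Finite := (SB_finite n).subset fun _ h => h.1

lemma cons_H_mem (n : ℕ) (w : List Step) : Step.H :: w ∈ SA (n + 1) ↔ w ∈ SA n := by
  simp only [SA, Set.mem_ofPred_eq, sch_cons_H, avoid_cons_H]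
  simp [semilength, countU, countH, ← add_assoc]

lemma append_H_mem (n : ℕ) (w : List Step) : w ++ [Step.H] ∈ SA (n + 1) ↔ w ∈ SA n := by
  simp only [SA, Set.mem_ofPred_eq, sch_append_H, avoid_append_H]
  simp [semilength, countU, countH, ← add_assoc]

lemma SA_succ (n : ℕ) : (SA (n + 1)).ncard = (SA n).ncard + (SB (n + 1)).ncard := by
  have : SA (n + 1) = (Step.H :: ·) '' SA n ∪ SB (n + 1) := by
    ext w
    constructor
    · intro h
      by_cases hw : w.head? = some Step.H
      · rcases w with _ | ⟨a, w⟩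
        · simp at hw
        · simp at hw
          subst hw
          exact Or.inl ⟨w, (cons_H_mem n w).1 h, rfl⟩
      · exact Or.inr ⟨h, hw⟩
    · rintro (⟨v, hv, rfl⟩ | h)
      · exact (cons_H_mem n v).2 hv
      · exact h.1
  rw [this, Set.ncard_union_eq ?_ ((SA_finite n).image _) (SB_finite _),
    Set.ncard_image_of_injective _ (List.cons_injective)]
  rw [Set.disjoint_left]
  rintro _ ⟨v, hv, rfl⟩ h
  exact h.2 rfl

lemma SB_succ (n : ℕ) :
    (SB (n + 1)).ncard = (SB n \ {[]}).ncard + (SE (n + 1)).ncard := by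
  have : SB (n + 1) = (· ++ [Step.H]) '' (SB n \ {[]}) ∪ SE (n + 1) := by
    ext w
    constructor
    · intro h
      by_cases hw : w.getLast? = some Step.H
      · obtain ⟨v, rfl⟩ := List.getLast?_eq_some_iff.1 hw
        left
        refine ⟨v, ⟨⟨(append_H_mem n v).1 h.1, ?_⟩, ?_⟩, rfl⟩
        · have := h.2
          rcases v <;> simp_all
        · rintro rfl
          exact h.2 rfl
      · exact Or.inr ⟨h, hw⟩
    · rintro (⟨v, hv, rfl⟩ | h)
      · refine ⟨(append_H_mem n v).2 hv.1.1, ?_⟩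
        have h1 := hv.1.2
        have h2 := hv.2
        rcases v <;> simp_all
      · exact h.1
  rw [this, Set.ncard_union_eq ?_ (((SB_finite n).sdiff).image _) (SE_finite _),
    Set.ncard_image_of_injective _ (List.append_left_injective _)]
  rw [Set.disjoint_left]
  rintro _ ⟨v, hv, rfl⟩ h
  exact h.2 (by simp)

lemma nil_mem_SB (n : ℕ) : [] ∈ SB n ↔ n = 0 := by
  simp only [SB, SA, Set.mem_ofPred_eq]
  constructor
  · rintro ⟨⟨-, h, -⟩, -⟩
    exact h.symm
  · rintro rfl
    refine ⟨⟨⟨fun p hp => ?_, rfl⟩, rfl, by simp⟩, by simp⟩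
    rw [List.prefix_nil.1 hp]
    exact le_rfl

/-- translation of Dyck steps -/
def tr : DyckStep → Step
  | .U => .U
  | .D => .D

lemma tr_inj : Function.Injective tr := by
  intro a b h
  cases a <;> cases b <;> simp_all [tr]

lemma count_tr_U (l : List DyckStep) : (l.map tr).count Step.U = l.count DyckStep.U :=
  List.count_map_of_injective l tr tr_inj DyckStep.U

lemma count_tr_D (l : List DyckStep) : (l.map tr).count Step.D = l.count DyckStep.D :=
  List.count_map_of_injective l tr tr_inj DyckStep.D

lemma H_not_mem_tr (l : List DyckStep) : Step.H ∉ l.map tr := by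
  rw [List.mem_map]
  rintro ⟨a, -, h⟩
  cases a <;> simp [tr] at h

lemma exists_tr (w : List Step) (h : Step.H ∉ w) : ∃ l : List DyckStep, l.map tr = w := by
  induction w with
  | nil => exact ⟨[], rfl⟩
  | cons a w ih =>
    simp only [List.mem_cons, not_or] at h
    obtain ⟨l, rfl⟩ := ih h.2
    cases a
    · exact ⟨.U :: l, rfl⟩
    · exact ⟨.D :: l, rfl⟩
    · exact absurd rfl h.1

lemma sch_tr (l : List DyckStep) : IsSchroder (l.map tr) ↔
    l.count .U = l.count .D ∧ ∀ i, (l.take i).count .D ≤ (l.take i).count .U := by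
  unfold IsSchroder countU countD
  rw [count_tr_D, count_tr_U, and_comm]
  refine and_congr_right fun _ => ⟨fun h i => ?_, fun h p hp => ?_⟩
  · have := h ((l.take i).map tr) ((List.take_prefix i l).map tr)
    rwa [count_tr_D, count_tr_U] at this
  · rw [List.prefix_iff_eq_take] at hp
    rw [hp, ← List.map_take, count_tr_D, count_tr_U]
    exact h _

lemma SE_no_H (n : ℕ) (w : List Step) (h : w ∈ SE n) : Step.H ∉ w := by
  obtain ⟨⟨⟨⟨h1, h1'⟩, -, h2⟩, h3⟩, h4⟩ := h
  intro hH
  rcases w with _ | ⟨a, v⟩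
  · simp at hH
  rcases List.eq_nil_or_concat v with rfl | ⟨u, b, rfl⟩
  · simp_all
  · have ha : a = Step.U := by
      have := h1 [a] (by simp)
      cases a <;> simp_all [countU, countD]
    subst ha
    have hb : b = Step.D := by
      have := h1 (Step.U :: u) (by simp)
      cases b
      · simp [countU, countD] at this h1'
        omega
      · rfl
      · refine absurd ?_ h4
        rw [List.concat_eq_append, ← List.cons_append, List.getLast?_append]
        rfl
    subst hb
    have hu : Step.H ∈ u := by simpa using hH
    apply h2
    rw [List.concat_eq_append]
    exact List.Sublist.cons_cons _
      (List.Sublist.append (List.singleton_sublist.2 hu) (List.Sublist.refl [Step.D]))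

lemma SE_card (n : ℕ) : (SE n).ncard = catalan n := by
  rw [← DyckWord.card_dyckWord_semilength_eq_catalan, ← Nat.card_eq_fintype_card,
    ← Nat.card_coe_set_eq]
  symm
  have key : ∀ p : DyckWord, p.semilength = n → p.toList.map tr ∈ SE n := by
    intro p hp
    have hH := H_not_mem_tr p.toList
    refine ⟨⟨⟨(sch_tr _).2 ⟨p.count_U_eq_count_D, p.count_D_le_count_U⟩, ?_, ?_⟩, ?_⟩, ?_⟩
    · unfold semilength countU countH
      rw [count_tr_U, List.count_eq_zero.2 hH]
      exact hp
    · intro h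
      exact hH (h.subset (by simp))
    · intro h
      exact hH (List.mem_of_head? h)
    · intro h
      exact hH (List.mem_of_getLast? h)
  refine Nat.card_congr (Equiv.ofBijective
    (fun p : {p : DyckWord // p.semilength = n} =>
      (⟨p.1.toList.map tr, key p.1 p.2⟩ : SE n)) ⟨?_, ?_⟩)
  · rintro ⟨p, hp⟩ ⟨q, hq⟩ h
    simp only [Subtype.mk.injEq] at h
    exact Subtype.ext (DyckWord.ext (tr_inj.list_map h))
  · rintro ⟨w, hw⟩
    have hH := SE_no_H n w hw
    obtain ⟨l, rfl⟩ := exists_tr w hH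
    have := (sch_tr l).1 hw.1.1.1
    refine ⟨⟨⟨l, this.1, this.2⟩, ?_⟩, rfl⟩
    have h2 := hw.1.1.2.1
    unfold semilength countU countH at h2
    rw [count_tr_U, List.count_eq_zero.2 hH] at h2
    exact h2

lemma SA_zero : SA 0 = {[]} := by
  ext w
  constructor
  · rintro ⟨h1, h2, -⟩
    have := len_eq w
    have := h1.2
    unfold semilength at h2
    exact List.length_eq_zero_iff.1 (by omega)
  · rintro rfl
    exact ((nil_mem_SB 0).2 rfl).1

lemma SB_zero : SB 0 = {[]} := by
  ext w
  constructor
  · intro h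
    have := h.1
    rwa [SA_zero] at this
  · rintro rfl
    exact (nil_mem_SB 0).2 rfl

lemma SB_one : (SB 1).ncard = 0 + catalan 1 := by
  rw [SB_succ 0, SB_zero, SE_card]
  simp

theorem schroder_avoid_UHD_gf :
    (1 - PowerSeries.X) ^ 2 *
        PowerSeries.mk (fun n => (schroderAvoidCount n [Step.U, Step.H, Step.D] : ℚ)) =
      PowerSeries.mk (fun n => (catalan n : ℚ)) - PowerSeries.X := by
  have hA : (fun n => (schroderAvoidCount n [Step.U, Step.H, Step.D] : ℚ)) =
      fun n => ((SA n).ncard : ℚ) := rfl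
  have h1 : (1 - PowerSeries.X) * PowerSeries.mk (fun n => ((SA n).ncard : ℚ)) =
      PowerSeries.mk (fun n => ((SB n).ncard : ℚ)) := by
    ext n
    rw [sub_mul, one_mul, map_sub]
    rcases n with _ | n
    · simp [SA_zero, SB_zero]
    · simp [PowerSeries.coeff_succ_X_mul, SA_succ]
  have h2 : (1 - PowerSeries.X) * PowerSeries.mk (fun n => ((SB n).ncard : ℚ)) =
      PowerSeries.mk (fun n => (catalan n : ℚ)) - PowerSeries.X := by
    ext n
    rw [sub_mul, one_mul, map_sub, map_sub]
    rcases n with _ | _ | n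
    · simp [SB_zero]
    · simp [PowerSeries.coeff_succ_X_mul, SB_one, SB_zero]
    · have h : SB (n + 1) \ {[]} = SB (n + 1) := by
        apply Set.sdiff_singleton_eq_self
        simp [nil_mem_SB]
      simp [PowerSeries.coeff_succ_X_mul, PowerSeries.coeff_X, SB_succ, h, SE_card]
  rw [hA, pow_two, mul_assoc, h1, h2]
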